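/- For δ ∈ (0, δ_max], let σ₋(δ) ∈ (0, m/2) and σ₊(δ) ∈ (m/2, 1/4) be the unique zeros in (0, 1/2) of A₋(·;δ) and A₊(·;δ) respectively. Then: (i) for σ ∈ (σ₋(δ), σ₊(δ)) one has A₊(σ;δ)·A₋(σ;δ) < 0 (so, by the eigenvalue formula λ² = −(9ρ₀²/256L¹⁴)·A₊·A₋, the origin of the h-averaged system with Γ = Lσ is a saddle); (ii) for σ ∈ (0, σ₋(δ)) ∪ (σ₊(δ), 1/2) one has A₊(σ;δ)·A₋(σ;δ) > 0 (a center); (iii) at σ = σ₋(δ) and σ = σ₊(δ), exactly one of A₊(σ;δ), A₋(σ;δ) vanishes while the other is nonzero (the linearization is a nonzero nilpotent matrix). Moreover, there exists a constant C* > 0 such that for all δ ∈ [0, δ_max]: |σ₊(δ) − m/2 − C₀·δ| ≤ C*·δ² and |σ₋(δ) − m/2 + C₀·δ| ≤ C*·δ², where C₀ = 5·U10·(m+3)·√(3 − 2m − m²)/(3·(16 + 20m)). -/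

import Mathlib

noncomputable section
open Real Set

namespace Secular

def U00 : ℝ := 0.762646
def U10 : ℝ := 0.547442
def U20 : ℝ := 0.237353
def mC : ℝ := (-4 + Real.sqrt 21) / 5
def rhoC : ℝ := 1.762157978551987e-18
def muC : ℝ := 398600.44
def aM : ℝ := 384400
def aMin : ℝ := 6378.14
def aMax : ℝ := 30000
def Lmin : ℝ := Real.sqrt (muC * aMin)
def Lmax : ℝ := Real.sqrt (muC * aMax)
def deltaFun (L : ℝ) : ℝ := rhoC * L ^ 10 / (muC ^ 3 * aM ^ 3)
def deltaMax : ℝ := deltaFun Lmax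
def rho0 : ℝ := muC ^ 4 * 1.08e-3 * 6378.14 ^ 2
def rho1 : ℝ := rhoC * rho0
def alphaCube (L : ℝ) : ℝ := L ^ 6 / (muC ^ 3 * aM ^ 3)

def aA (σ : ℝ) : ℝ := 1 - 16 * σ - 20 * σ ^ 2
def bB (σ : ℝ) : ℝ := (2 * σ + 3) * Real.sqrt (3 - 4 * σ - 4 * σ ^ 2)
def cPl (σ : ℝ) : ℝ := U00 / 2 * aA σ + 5 * U10 / 3 * bB σ
def cMi (σ : ℝ) : ℝ := U00 / 2 * aA σ - 5 * U10 / 3 * bB σ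
def Ap (σ δ : ℝ) : ℝ := aA σ + δ * cPl σ
def Am (σ δ : ℝ) : ℝ := aA σ + δ * cMi σ


def C0 : ℝ := 5 * U10 * (mC + 3) * Real.sqrt (3 - 2 * mC - mC ^ 2) / (3 * (16 + 20 * mC))

theorem U10_scaled_bounds : 0 < 5 * U10 / 3 ∧ 5 * U10 / 3 ≤ 0.9125 := by
  norm_num [U10]

theorem U00_half_bounds : 0 < U00 / 2 ∧ U00 / 2 ≤ 0.39 := by
  norm_num [U00]

theorem deltaMax_le : deltaMax ≤ 0.12 := by
  have h : Lmax ^ 10 = (muC * aMax) ^ 5 := by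
    have h2 : Lmax ^ 2 = muC * aMax := Real.sq_sqrt (by norm_num [muC, aMax])
    rw [← h2]; ring
  rw [deltaMax, deltaFun, h]
  norm_num [rhoC, muC, aMax, aM]

theorem mC_bounds : 0 < mC ∧ mC < 0.12 := by
  have h1 : (4.5 : ℝ) < √21 := Real.lt_sqrt_of_sq_lt (by norm_num)
  have h2 : √21 < (4.6 : ℝ) := (Real.sqrt_lt' (by norm_num)).2 (by norm_num)
  constructor <;> unfold mC <;> linarith

theorem aA_eq_mul (σ : ℝ) : aA σ = -((σ - mC / 2) * (16 + 20 * (σ + mC / 2))) := by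
  have h : √21 ^ 2 = (21 : ℝ) := Real.sq_sqrt (by norm_num)
  unfold aA mC
  linear_combination -h / 5

theorem aA_strictAnti {x y : ℝ} (hx : 0 ≤ x) (hxy : x < y) : 16 * (y - x) < aA x - aA y := by
  unfold aA
  nlinarith

theorem bB_sq {σ : ℝ} (h0 : 0 ≤ σ) (h1 : σ ≤ 1 / 2) :
    bB σ ^ 2 = 27 - 72 * σ ^ 2 - 64 * σ ^ 3 - 16 * σ ^ 4 := by
  rw [bB, mul_pow, Real.sq_sqrt (by nlinarith)]
  ring

theorem bB_pos {σ : ℝ} (h0 : 0 ≤ σ) (h1 : σ < 1 / 2) : 0 < bB σ :=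
  mul_pos (by linarith) (Real.sqrt_pos.2 (by nlinarith))

theorem bB_antitone {x y : ℝ} (hx : 0 ≤ x) (hxy : x ≤ y) (hy : y < 1 / 2) : bB y ≤ bB x := by
  refine (abs_le_of_sq_le_sq' ?_ (bB_pos hx (hxy.trans_lt hy)).le).2
  rw [bB_sq hx (hxy.trans hy.le), bB_sq (hx.trans hxy) hy.le]
  gcongr

theorem bB_le {σ : ℝ} (h0 : 0 ≤ σ) (h1 : σ < 1 / 2) : bB σ ≤ 5.2 := by
  refine (bB_antitone le_rfl h0 h1).trans (abs_le_of_sq_le_sq' ?_ (by norm_num)).2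
  rw [bB_sq le_rfl (by norm_num)]
  norm_num

theorem bB_sub_le {x y : ℝ} (hx : 0 ≤ x) (hxy : x ≤ y) (hy : y ≤ 1 / 4) :
    bB x - bB y ≤ 8 * (y - x) := by
  have hlow : 4.5 ≤ bB y := by
    refine le_trans ?_ (bB_antitone (hx.trans hxy) hy (by norm_num))
    refine (abs_le_of_sq_le_sq' ?_ (bB_pos (by norm_num) (by norm_num)).le).2
    rw [bB_sq (by norm_num) (by norm_num)]
    norm_num
  have hmono := bB_antitone hx hxy (by linarith)
  have hsq : bB x ^ 2 - bB y ^ 2 ≤ 49 * (y - x) := by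
    rw [bB_sq hx (by linarith), bB_sq (hx.trans hxy) (by linarith)]
    have hy0 := hx.trans hxy
    have hx4 := hxy.trans hy
    have h2 : 72 * (x + y) + 64 * (x ^ 2 + x * y + y ^ 2) + 16 * (x + y) * (x ^ 2 + y ^ 2)
        ≤ 49 := by
      calc _ ≤ 72 * (1 / 4 + 1 / 4) + 64 * ((1 / 4) ^ 2 + 1 / 4 * (1 / 4) + (1 / 4) ^ 2)
            + 16 * (1 / 4 + 1 / 4) * ((1 / 4) ^ 2 + (1 / 4 : ℝ) ^ 2) := by gcongr
        _ ≤ 49 := by norm_num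
    nlinarith [mul_le_mul_of_nonneg_left h2 (sub_nonneg.2 hxy)]
  nlinarith

theorem abs_bB_sub_le {x y : ℝ} (hx : 0 ≤ x) (hx' : x ≤ 1 / 4) (hy : 0 ≤ y) (hy' : y ≤ 1 / 4) :
    |bB x - bB y| ≤ 8 * |x - y| := by
  rcases le_total x y with h | h
  · rw [abs_of_nonneg (sub_nonneg.2 (bB_antitone hx h (by linarith))), abs_sub_comm,
      abs_of_nonneg (sub_nonneg.2 h)]
    exact bB_sub_le hx h hy'
  · rw [abs_sub_comm, abs_of_nonneg (sub_nonneg.2 (bB_antitone hy h (by linarith))),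
      abs_of_nonneg (sub_nonneg.2 h)]
    exact bB_sub_le hy h hx'

theorem Ap_eq (σ δ : ℝ) :
    Ap σ δ = (1 + δ * (U00 / 2)) * aA σ + δ * (5 * U10 / 3 * bB σ) := by
  unfold Ap cPl; ring

theorem Am_eq (σ δ : ℝ) :
    Am σ δ = (1 + δ * (U00 / 2)) * aA σ - δ * (5 * U10 / 3 * bB σ) := by
  unfold Am cMi; ring

theorem Am_lt_Ap {σ δ : ℝ} (hδ : 0 < δ) (h0 : 0 ≤ σ) (h1 : σ < 1 / 2) : Am σ δ < Ap σ δ := by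
  have := mul_pos hδ (mul_pos U10_scaled_bounds.1 (bB_pos h0 h1))
  rw [Am_eq, Ap_eq]
  linarith

theorem Ap_strictAnti {x y δ : ℝ} (hδ : 0 ≤ δ) (hx : 0 ≤ x) (hxy : x < y) (hy : y < 1 / 2) :
    Ap y δ < Ap x δ := by
  have ha : aA y < aA x := by linarith [aA_strictAnti hx hxy]
  have hb := bB_antitone hx hxy.le hy
  have hc := U10_scaled_bounds.1.le
  have hk : 0 < 1 + δ * (U00 / 2) := by linarith [mul_nonneg hδ U00_half_bounds.1.le]
  rw [Ap_eq, Ap_eq]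
  refine add_lt_add_of_lt_of_le ?_ ?_ <;> gcongr

theorem Am_strictAnti {x y δ : ℝ} (hδ : 0 ≤ δ) (hδ' : δ ≤ 0.12) (hx : 0 ≤ x) (hxy : x < y)
    (hy : y ≤ 1 / 4) : Am y δ < Am x δ := by
  have ha := aA_strictAnti hx hxy
  have hb := bB_sub_le hx hxy.le hy
  obtain ⟨hc, hc'⟩ := U10_scaled_bounds
  have hk : 0 ≤ δ * (U00 / 2) := mul_nonneg hδ U00_half_bounds.1.le
  have hδc : δ * (5 * U10 / 3) ≤ 0.12 * 0.9125 := by gcongr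
  have h1 : δ * (5 * U10 / 3) * (bB x - bB y) ≤ 0.12 * 0.9125 * (8 * (y - x)) := by
    have : 0 ≤ bB x - bB y := sub_nonneg.2 (bB_antitone hx hxy.le (by linarith))
    gcongr
  have h2 : 0 ≤ δ * (U00 / 2) * (aA x - aA y) := mul_nonneg hk (by linarith)
  rw [Am_eq, Am_eq]
  nlinarith

theorem aA_neg_of_lt {σ : ℝ} (h : mC / 2 < σ) : aA σ < 0 := by
  have := mC_bounds.1
  rw [aA_eq_mul]
  exact neg_neg_of_pos (mul_pos (by linarith) (by linarith))

theorem Am_neg_of_lt {σ δ : ℝ} (hδ : 0 ≤ δ) (h : mC / 2 < σ) (h1 : σ < 1 / 2) :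
    Am σ δ < 0 := by
  have hk : 0 < 1 + δ * (U00 / 2) := by linarith [mul_nonneg hδ U00_half_bounds.1.le]
  have h2 := mul_nonneg hδ (mul_pos U10_scaled_bounds.1
    (bB_pos (by linarith [mC_bounds.1]) h1)).le
  have h3 := mul_neg_of_pos_of_neg hk (aA_neg_of_lt h)
  rw [Am_eq]
  linarith

theorem C0_eq : C0 * (16 + 20 * mC) = 5 * U10 / 3 * bB (mC / 2) := by
  have hD : 16 + 20 * mC ≠ 0 := by linarith [mC_bounds.1]
  have hr : 3 - 4 * (mC / 2) - 4 * (mC / 2) ^ 2 = 3 - 2 * mC - mC ^ 2 := by ring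
  rw [C0, bB, hr, div_mul_eq_mul_div, div_eq_iff (mul_ne_zero three_ne_zero hD)]
  ring

/-- A zero of `k·𝐚 + t·(5·U10/3)·𝐛` with `k = 1 + |t|·U00/2` is `m/2 + C₀·t + O(t²)`; the zeros of
`A₊` and `A₋` are the cases `t = δ` and `t = -δ`. -/
theorem abs_zero_sub_le {σ t : ℝ} (ht : |t| ≤ 0.12) (h0 : 0 < σ) (h1 : σ < 1 / 2)
    (h : (1 + |t| * (U00 / 2)) * aA σ + t * (5 * U10 / 3 * bB σ) = 0) :
    |σ - mC / 2 - C0 * t| ≤ 10 * t ^ 2 := by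
  obtain ⟨hm, hm'⟩ := mC_bounds
  obtain ⟨hc, hc'⟩ := U10_scaled_bounds
  obtain ⟨hu, hu'⟩ := U00_half_bounds
  have hC0 := C0_eq
  have hb := bB_pos h0.le h1
  have hb' := bB_le h0.le h1
  rw [aA_eq_mul] at h
  set s := σ - mC / 2 with hs
  set c := 5 * U10 / 3
  set u := U00 / 2
  have ht0 := abs_nonneg t
  have hs0 := abs_nonneg s
  have hsmall : |s| ≤ 0.3 * |t| := by
    have h2 : (1 + |t| * u) * (|s| * (16 + 20 * (σ + mC / 2))) = |t| * (c * bB σ) := by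
      have h3 : (1 + |t| * u) * (s * (16 + 20 * (σ + mC / 2))) = t * (c * bB σ) := by linarith
      have h4 := congrArg abs h3
      rwa [abs_mul, abs_mul, abs_mul, abs_of_pos (by positivity : 0 < 1 + |t| * u),
        abs_of_pos (by positivity : 0 < 16 + 20 * (σ + mC / 2)),
        abs_of_pos (by positivity : 0 < c * bB σ)] at h4
    have h5 : 1 * (|s| * 16) ≤ (1 + |t| * u) * (|s| * (16 + 20 * (σ + mC / 2))) := by
      gcongr
      · linarith [mul_nonneg ht0 hu.le]
      · linarith
    have h6 : |t| * (c * bB σ) ≤ |t| * (0.9125 * 5.2) := by gcongr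
    linarith
  have hσ : σ ≤ 1 / 4 := by linarith [le_abs_self s]
  have hlip := abs_bB_sub_le h0.le hσ (by linarith : 0 ≤ mC / 2) (by linarith)
  have key : (16 + 20 * mC) * (s - C0 * t) =
      t * c * (bB σ - bB (mC / 2)) - |t| * u * (16 + 20 * mC) * s
        - 20 * (1 + |t| * u) * (s * s) := by
    have h7 : σ + mC / 2 = s + mC := by rw [hs]; ring
    rw [h7] at h
    linear_combination -h - t * hC0
  have hbound : (16 + 20 * mC) * |s - C0 * t| ≤ 10 * |t| ^ 2 := by
    rw [← abs_of_pos (by positivity : 0 < 16 + 20 * mC), ← abs_mul, key]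
    calc _ ≤ |t * c * (bB σ - bB (mC / 2))| + |(|t| * u * (16 + 20 * mC) * s)|
          + |20 * (1 + |t| * u) * (s * s)| :=
          (abs_sub _ _).trans (add_le_add_left (abs_sub _ _) _)
      _ = |t| * c * |bB σ - bB (mC / 2)| + |t| * u * (16 + 20 * mC) * |s|
          + 20 * (1 + |t| * u) * (|s| * |s|) := by
          simp only [abs_mul, abs_abs, abs_of_pos hc, abs_of_pos hu,
            abs_of_pos (by positivity : 0 < 16 + 20 * mC),
            abs_of_pos (by positivity : 0 < 1 + |t| * u), abs_of_pos (by norm_num : (0:ℝ) < 20)]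
      _ ≤ |t| * 0.9125 * (8 * (0.3 * |t|)) + |t| * 0.39 * (16 + 20 * 0.12) * (0.3 * |t|)
          + 20 * (1 + 0.12 * 0.39) * ((0.3 * |t|) * (0.3 * |t|)) := by
          have := hlip.trans (mul_le_mul_of_nonneg_left hsmall (by norm_num : (0:ℝ) ≤ 8))
          gcongr
      _ ≤ 10 * |t| ^ 2 := by nlinarith [sq_nonneg |t|]
  rw [sq_abs] at hbound
  nlinarith [abs_nonneg (s - C0 * t)]

/-- sign of `A₊·A₋` between/outside the zeros `σ₋(δ) < σ₊(δ)` (saddle/center of the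
origin of the averaged system), degeneracy at the zeros, and first-order asymptotics
`σ₊(δ) = m/2 + C₀δ + O(δ²)`, `σ₋(δ) = m/2 − C₀δ + O(δ²)`. -/
theorem stmt2 :
    ∃ Cstar > (0:ℝ),
      (∀ δ ∈ Set.Ioc (0:ℝ) deltaMax,
        ∀ σm ∈ Set.Ioo (0:ℝ) (1/2), ∀ σp ∈ Set.Ioo (0:ℝ) (1/2),
          Am σm δ = 0 → Ap σp δ = 0 →
            (∀ σ ∈ Set.Ioo σm σp, Ap σ δ * Am σ δ < 0) ∧
            (∀ σ ∈ Set.Ioo (0:ℝ) σm ∪ Set.Ioo σp (1/2), 0 < Ap σ δ * Am σ δ) ∧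
            (Am σm δ = 0 ∧ Ap σm δ ≠ 0) ∧ (Ap σp δ = 0 ∧ Am σp δ ≠ 0)) ∧
      (∀ δ ∈ Set.Icc (0:ℝ) deltaMax,
        ∀ σm ∈ Set.Ioo (0:ℝ) (1/2), ∀ σp ∈ Set.Ioo (0:ℝ) (1/2),
          Am σm δ = 0 → Ap σp δ = 0 →
            |σp - mC / 2 - C0 * δ| ≤ Cstar * δ ^ 2 ∧
            |σm - mC / 2 + C0 * δ| ≤ Cstar * δ ^ 2) := by
  refine ⟨10, by norm_num, ?_, ?_⟩
  · rintro δ ⟨hδ, hδ'⟩ σm ⟨hm0, hm1⟩ σp ⟨hp0, hp1⟩ hm hp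
    have hδm := hδ'.trans deltaMax_le
    have hmC := mC_bounds.2
    have hσm : σm ≤ mC / 2 := by
      by_contra! hlt
      exact (Am_neg_of_lt hδ.le hlt hm1).ne hm
    refine ⟨fun σ ⟨hl, hr⟩ => ?_, ?_, ⟨hm, ?_⟩, hp, ?_⟩
    · have h1 := Ap_strictAnti hδ.le (hm0.trans hl).le hr hp1
      refine mul_neg_of_pos_of_neg (hp ▸ h1) ?_
      rcases le_or_gt σ (mC / 2) with h | h
      · exact hm ▸ Am_strictAnti hδ.le hδm hm0.le hl (by linarith)
      · exact Am_neg_of_lt hδ.le h (hr.trans hp1)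
    · rintro σ (⟨hl, hr⟩ | ⟨hl, hr⟩)
      · have h1 := Am_strictAnti hδ.le hδm hl.le hr (by linarith)
        rw [hm] at h1
        exact mul_pos (h1.trans (Am_lt_Ap hδ hl.le (hr.trans hm1))) h1
      · have h1 := Ap_strictAnti hδ.le hp0.le hl hr
        rw [hp] at h1
        exact mul_pos_of_neg_of_neg h1 ((Am_lt_Ap hδ (hp0.trans hl).le hr).trans h1)
    · exact (hm ▸ Am_lt_Ap hδ hm0.le hm1).ne'
    · exact (hp ▸ Am_lt_Ap hδ hp0.le hp1).ne
  · rintro δ ⟨hδ, hδ'⟩ σm ⟨hm0, hm1⟩ σp ⟨hp0, hp1⟩ hm hp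
    have hδm := hδ'.trans deltaMax_le
    rw [Am_eq] at hm
    rw [Ap_eq] at hp
    constructor
    · exact abs_zero_sub_le (by rwa [abs_of_nonneg hδ]) hp0 hp1 (by rwa [abs_of_nonneg hδ])
    · have h := abs_zero_sub_le (t := -δ) (by rwa [abs_neg, abs_of_nonneg hδ]) hm0 hm1
        (by rw [abs_neg, abs_of_nonneg hδ]; linarith)
      rwa [mul_neg, sub_neg_eq_add, neg_sq] at h

end Secular
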